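/- Suppose the embedding D(A) ∩ closure(R(A*)) ↪ X is compact. Then the restricted inverse 𝓐⁻¹ : R(A) → R(A*), mapping y = A x (with x ∈ D(A) ∩ R(A*)) to x, is a compact operator from R(A) to R(A*). -/

import Mathlib

open scoped InnerProductSpace

/-- The range of a partially defined linear map, as a submodule of the codomain. -/
def LinearPMap.pmRange {R E F : Type*} [Ring R] [AddCommGroup E] [Module R E]
    [AddCommGroup F] [Module R F] (T : E →ₗ.[R] F) : Submodule R F :=
  LinearMap.range T.toFun

namespace LinearPMap

variable {X Y : Type*} [NormedAddCommGroup X] [InnerProductSpace ℝ X] [CompleteSpace X]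
  [NormedAddCommGroup Y] [InnerProductSpace ℝ Y]

/-- The kernel of `A` meets the closure of the range of the adjoint only in zero. -/
theorem eq_zero_of_mem_closure_pmRange_adjoint {A : X →ₗ.[ℝ] Y}
    (hdense : Dense (A.domain : Set X)) (x : A.domain)
    (hx : (x : X) ∈ _root_.closure (A.adjoint.pmRange : Set X)) (hAx : A x = 0) : (x : X) = 0 := by
  have horth : _root_.closure (A.adjoint.pmRange : Set X) ⊆ {z : X | ⟪z, (x : X)⟫_ℝ = 0} := by
    refine closure_minimal ?_ (isClosed_eq (by fun_prop) continuous_const)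
    rintro _ ⟨y, rfl⟩
    have h : ⟪A.adjoint y, (x : X)⟫_ℝ = ⟪(y : Y), A x⟫_ℝ := A.adjoint_isFormalAdjoint hdense y x
    rw [hAx, inner_zero_right] at h
    exact h
  exact inner_self_eq_zero.mp (horth hx)

/-- A Friedrichs/Poincaré type estimate: if `D(A) ∩ closure (R(A*))` embeds compactly, then `A` is
bounded below there. -/
theorem exists_norm_le_mul_norm_apply {A : X →ₗ.[ℝ] Y}
    (hdense : Dense (A.domain : Set X)) (hclosed : A.IsClosed)
    (hcomp : ∀ u : ℕ → A.domain,
      (∀ n, (u n : X) ∈ _root_.closure (A.adjoint.pmRange : Set X)) →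
      (∃ C : ℝ, ∀ n, ‖(u n : X)‖ ^ 2 + ‖A (u n)‖ ^ 2 ≤ C) →
      ∃ (x : X) (φ : ℕ → ℕ), StrictMono φ ∧
        Filter.Tendsto (fun n => (u (φ n) : X)) Filter.atTop (nhds x)) :
    ∃ c : ℝ, 0 ≤ c ∧ ∀ x : A.domain, (x : X) ∈ _root_.closure (A.adjoint.pmRange : Set X) →
      ‖(x : X)‖ ≤ c * ‖A x‖ := by
  by_contra! hcon
  choose v hvmem hv using fun n : ℕ => hcon (n + 1 : ℝ) (by positivity)
  have hvpos : ∀ n, 0 < ‖(v n : X)‖ := fun n => lt_of_le_of_lt (by positivity) (hv n)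
  let u : ℕ → A.domain := fun n => ‖(v n : X)‖⁻¹ • v n
  have hmem : ∀ n, (u n : X) ∈ _root_.closure (A.adjoint.pmRange : Set X) := fun n =>
    A.adjoint.pmRange.topologicalClosure.smul_mem _ (hvmem n)
  have hunorm : ∀ n, ‖(u n : X)‖ = 1 := fun n => by
    simp [u, norm_smul, (hvpos n).ne']
  have hAu : ∀ n, ‖A (u n)‖ ≤ 1 / ((n : ℝ) + 1) := fun n => by
    have h : ‖A (u n)‖ = ‖A (v n)‖ / ‖(v n : X)‖ := by
      simp [u, LinearPMap.map_smul, norm_smul, div_eq_inv_mul]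
    rw [h, div_le_div_iff₀ (hvpos n) (by positivity)]
    linarith [hv n]
  obtain ⟨x, φ, hφ, hx⟩ := hcomp u hmem ⟨2, fun n => by
    have h1 : ‖A (u n)‖ ≤ 1 := (hAu n).trans <| by
      rw [div_le_one (by positivity)]
      linarith [n.cast_nonneg (α := ℝ)]
    rw [hunorm]
    nlinarith [norm_nonneg (A (u n))]⟩
  have hA0 : Filter.Tendsto (fun n => A (u (φ n))) Filter.atTop (nhds 0) :=
    (squeeze_zero_norm hAu tendsto_one_div_add_atTop_nhds_zero_nat).comp hφ.tendsto_atTop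
  have hgraph : (x, (0 : Y)) ∈ A.graph :=
    hclosed.mem_of_tendsto (hx.prodMk_nhds hA0) (.of_forall fun n => A.mem_graph (u (φ n)))
  obtain ⟨z, hzx, hz0⟩ := (A.mem_graph_iff).mp hgraph
  have hxcl : x ∈ _root_.closure (A.adjoint.pmRange : Set X) :=
    isClosed_closure.mem_of_tendsto hx (.of_forall fun n => hmem (φ n))
  have hx0 : x = 0 := hzx.symm.trans <|
    eq_zero_of_mem_closure_pmRange_adjoint hdense z (by simpa [hzx] using hxcl) hz0
  have hxnorm : ‖x‖ = 1 := tendsto_nhds_unique hx.norm (by simp [hunorm])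
  simp [hx0] at hxnorm

end LinearPMap

/-- Under the compactness of the embedding `D(A) ∩ closure (R(A*)) ↪ X`,
the inverse `𝓐⁻¹ : R(A) → R(A*)`, mapping `y = A x` (with `x ∈ D(A) ∩ R(A*)`) to `x`,
is a compact operator: for every sequence `xₙ ∈ D(A) ∩ R(A*)` with `(A xₙ)` bounded, the
sequence `(xₙ)` has a subsequence converging in `X` to an element of `R(A*)`
(more precisely of its closure). -/
theorem stmt7
    {X Y : Type*} [NormedAddCommGroup X] [InnerProductSpace ℝ X] [CompleteSpace X]
    [NormedAddCommGroup Y] [InnerProductSpace ℝ Y] [CompleteSpace Y]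
    (A : X →ₗ.[ℝ] Y) (hdense : Dense (A.domain : Set X)) (hclosed : A.IsClosed)
    (hcomp : ∀ u : ℕ → A.domain,
      (∀ n, (u n : X) ∈ closure (A.adjoint.pmRange : Set X)) →
      (∃ C : ℝ, ∀ n, ‖(u n : X)‖ ^ 2 + ‖A (u n)‖ ^ 2 ≤ C) →
      ∃ (x : X) (φ : ℕ → ℕ), StrictMono φ ∧
        Filter.Tendsto (fun n => (u (φ n) : X)) Filter.atTop (nhds x)) :
    ∀ u : ℕ → A.domain,
      (∀ n, (u n : X) ∈ A.adjoint.pmRange) →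
      (∃ C : ℝ, ∀ n, ‖A (u n)‖ ≤ C) →
      ∃ (x : X) (φ : ℕ → ℕ), StrictMono φ ∧ x ∈ closure (A.adjoint.pmRange : Set X) ∧
        Filter.Tendsto (fun n => (u (φ n) : X)) Filter.atTop (nhds x) := by
  rintro u hu ⟨C, hC⟩
  have hmem : ∀ n, (u n : X) ∈ closure (A.adjoint.pmRange : Set X) := fun n => subset_closure (hu n)
  obtain ⟨c, hc, hbound⟩ := LinearPMap.exists_norm_le_mul_norm_apply hdense hclosed hcomp
  obtain ⟨x, φ, hφ, hx⟩ := hcomp u hmem ⟨(c * C) ^ 2 + C ^ 2, fun n => by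
    have hun : ‖(u n : X)‖ ≤ c * C := (hbound _ (hmem n)).trans (by gcongr; exact hC n)
    gcongr
    exact hC n⟩
  exact ⟨x, φ, hφ, isClosed_closure.mem_of_tendsto hx (.of_forall fun n => hmem (φ n)), hx⟩
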